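/- Let n ≥ 3, let A ⊂ ℕ∖{0} with |A| = n, and let c > 2 be an integer. Assume that for every a ∈ A one has a + 2 ≡ 0 (mod c) or a + 2 ≡ 1 (mod c). Then the polynomials h_a(n), a ∈ A, have a common zero in ℂ^n different from the origin (i.e., h_A(n) is not a regular sequence). -/

import Mathlib

theorem sum_antidiagonalTuple_cons {R : Type*} [CommSemiring R] (n a : ℕ) (x : R) (z : Fin n → R) :
    ∑ d ∈ Finset.Nat.antidiagonalTuple (n + 1) a, ∏ i, (Fin.cons x z : Fin (n + 1) → R) i ^ d i =
      ∑ p ∈ Finset.HasAntidiagonal.antidiagonal a,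
        x ^ p.1 * ∑ d ∈ Finset.Nat.antidiagonalTuple n p.2, ∏ i, z i ^ d i := by
  simp_rw [Finset.mul_sum]
  rw [Finset.sum_sigma']
  refine Finset.sum_bij' (fun d _ ↦ ⟨(d 0, ∑ i, Fin.tail d i), Fin.tail d⟩)
    (fun q _ ↦ Fin.cons q.1.1 q.2) ?_ ?_ ?_ ?_ ?_
  · intro d hd
    rw [Finset.Nat.mem_antidiagonalTuple, Fin.sum_univ_succ] at hd
    simp [Finset.Nat.mem_antidiagonalTuple, Fin.tail, hd]
  · rintro ⟨⟨i, j⟩, d⟩ hd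
    simp only [Finset.mem_sigma, Finset.HasAntidiagonal.mem_antidiagonal,
      Finset.Nat.mem_antidiagonalTuple] at hd
    simp [Finset.Nat.mem_antidiagonalTuple, Fin.sum_univ_succ, hd]
  · intro d _
    simp
  · rintro ⟨⟨i, j⟩, d⟩ hd
    simp only [Finset.mem_sigma, Finset.HasAntidiagonal.mem_antidiagonal,
      Finset.Nat.mem_antidiagonalTuple] at hd
    simp [hd]
  · intro d _
    simp [Fin.prod_univ_succ, Fin.tail]

theorem sum_antidiagonalTuple_cons_zero {R : Type*} [CommSemiring R] (n a : ℕ) (z : Fin n → R) :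
    ∑ d ∈ Finset.Nat.antidiagonalTuple (n + 1) a, ∏ i, (Fin.cons 0 z : Fin (n + 1) → R) i ^ d i =
      ∑ d ∈ Finset.Nat.antidiagonalTuple n a, ∏ i, z i ^ d i := by
  rw [sum_antidiagonalTuple_cons, Finset.sum_eq_single (0, a)]
  · simp
  · rintro ⟨i, j⟩ h hne
    have hi : i ≠ 0 := by
      rintro rfl
      simp_all
    simp [hi]
  · simp

theorem sub_mul_sum_antidiagonal_pow {R : Type*} [CommRing R] (x y : R) (a : ℕ) :
    (x - y) * ∑ p ∈ Finset.HasAntidiagonal.antidiagonal a, x ^ p.1 * y ^ p.2 =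
      x ^ (a + 1) - y ^ (a + 1) := by
  rw [Finset.Nat.sum_antidiagonal_eq_sum_range_succ (fun i j ↦ x ^ i * y ^ j), mul_comm]
  exact geom_sum₂_mul x y (a + 1)

/-- The bialternant formula for the complete homogeneous symmetric polynomials in three
variables. -/
theorem vandermonde_mul_sum_antidiagonalTuple_three {R : Type*} [CommRing R] (x y w : R) (a : ℕ) :
    (x - y) * (x - w) * (y - w) *
        ∑ d ∈ Finset.Nat.antidiagonalTuple 3 a, ∏ i, (![x, y, w] : Fin 3 → R) i ^ d i =
      (y - w) * x ^ (a + 2) - (x - w) * y ^ (a + 2) + (x - y) * w ^ (a + 2) := by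
  have h_two (j : ℕ) :
      (y - w) * ∑ d ∈ Finset.Nat.antidiagonalTuple 2 j, ∏ i, (![y, w] : Fin 2 → R) i ^ d i =
        y ^ (j + 1) - w ^ (j + 1) := by
    rw [← sub_mul_sum_antidiagonal_pow, Finset.Nat.antidiagonalTuple_two]
    simp [Fin.prod_univ_two]
  have h_three : (y - w) *
        ∑ d ∈ Finset.Nat.antidiagonalTuple 3 a, ∏ i, (![x, y, w] : Fin 3 → R) i ^ d i =
      y * ∑ p ∈ Finset.HasAntidiagonal.antidiagonal a, x ^ p.1 * y ^ p.2 -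
        w * ∑ p ∈ Finset.HasAntidiagonal.antidiagonal a, x ^ p.1 * w ^ p.2 := by
    have h_cons := sum_antidiagonalTuple_cons 2 a x ![y, w]
    refine (congrArg ((y - w) * ·) h_cons).trans ?_
    simp only [Finset.mul_sum, ← Finset.sum_sub_distrib]
    refine Finset.sum_congr rfl fun p _ ↦ ?_
    rw [← Finset.mul_sum, ← Finset.mul_sum]
    linear_combination x ^ p.1 * h_two p.2
  linear_combination (x - y) * (x - w) * h_three +
    y * (x - w) * sub_mul_sum_antidiagonal_pow x y a -
    w * (x - y) * sub_mul_sum_antidiagonal_pow x w a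

theorem sum_antidiagonalTuple_three_eq_zero {R : Type*} [CommRing R] [IsDomain R] {x y w : R}
    {c a : ℕ} (hxy : x ≠ y) (hxw : x ≠ w) (hyw : y ≠ w) (hx : x ^ c = 1) (hy : y ^ c = 1)
    (hw : w ^ c = 1) (ha : (a + 2) % c = 0 ∨ (a + 2) % c = 1) :
    ∑ d ∈ Finset.Nat.antidiagonalTuple 3 a, ∏ i, (![x, y, w] : Fin 3 → R) i ^ d i = 0 := by
  have h := vandermonde_mul_sum_antidiagonalTuple_three x y w a
  rw [pow_eq_pow_mod (a + 2) hx, pow_eq_pow_mod (a + 2) hy, pow_eq_pow_mod (a + 2) hw] at h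
  have h_rhs : (y - w) * x ^ ((a + 2) % c) - (x - w) * y ^ ((a + 2) % c) +
      (x - y) * w ^ ((a + 2) % c) = 0 := by
    rcases ha with ha | ha <;> rw [ha] <;> ring
  refine (mul_eq_zero.mp (h.trans h_rhs)).resolve_left ?_
  exact mul_ne_zero (mul_ne_zero (sub_ne_zero.mpr hxy) (sub_ne_zero.mpr hxw)) (sub_ne_zero.mpr hyw)

/-- Let `n ≥ 3`, `A ⊂ ℕ∖{0}` with `|A| = n`, and `c > 2` an integer. Assume
that for every `a ∈ A` one has `a + 2 ≡ 0 (mod c)` or `a + 2 ≡ 1 (mod c)`. Then the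
complete homogeneous symmetric polynomials `h_a(n)`, `a ∈ A`, have a common zero in `ℂ^n`
different from the origin. The value of `h_a(n)` at `z` is `∑_{d₁+⋯+d_n = a} ∏ z_i^{d_i}`. -/
theorem stmt8 (n : ℕ) (hn : 3 ≤ n) (A : Finset ℕ) (hA0 : 0 ∉ A) (hcard : A.card = n)
    (c : ℕ) (hc : 2 < c) (hmod : ∀ a ∈ A, (a + 2) % c = 0 ∨ (a + 2) % c = 1) :
    ∃ z : Fin n → ℂ, z ≠ 0 ∧
      ∀ a ∈ A, ∑ d ∈ Finset.Nat.antidiagonalTuple n a, ∏ i : Fin n, z i ^ d i = 0 := by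
  obtain ⟨m, rfl⟩ := Nat.exists_eq_add_of_le' hn
  clear hn hcard hA0
  induction m with
  | zero =>
    have hζ := Complex.isPrimitiveRoot_exp c (by omega)
    set ζ := Complex.exp (2 * Real.pi * Complex.I / c)
    have h_ne {i j : ℕ} (hi : i < c) (hj : j < c) (hij : i ≠ j) : ζ ^ i ≠ ζ ^ j :=
      fun h ↦ hij (hζ.pow_inj hi hj h)
    have h_pow (i : ℕ) : (ζ ^ i) ^ c = 1 := by
      rw [← pow_mul, mul_comm, pow_mul, hζ.pow_eq_one, one_pow]
    refine ⟨![ζ ^ 0, ζ ^ 1, ζ ^ 2], fun h ↦ ?_, fun a ha ↦ ?_⟩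
    · simpa using congrFun h 0
    · exact sum_antidiagonalTuple_three_eq_zero (h_ne (by omega) (by omega) (by omega))
        (h_ne (by omega) (by omega) (by omega)) (h_ne (by omega) (by omega) (by omega))
        (h_pow 0) (h_pow 1) (h_pow 2) (hmod a ha)
  | succ m ih =>
    obtain ⟨z, hz, hzA⟩ := ih
    refine ⟨Fin.cons 0 z, fun h ↦ hz ?_, fun a ha ↦ ?_⟩
    · funext i
      simpa using congrFun h i.succ
    · exact (sum_antidiagonalTuple_cons_zero (m + 3) a z).trans (hzA a ha)
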